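/- Each of the functions t ↦ t · φ'(t), t ↦ t² · φ''(t), and t ↦ t³ · φ'''(t) tends to 0 as t → 0⁺ (limit along 𝓝[>] 0), where φ', φ'', φ''' denote the first, second and third derivatives of φ. -/

import Mathlib

open Filter
open scoped Topology

/-- `φ(t) = log (log (e − log t))`. -/
noncomputable def φ (t : ℝ) : ℝ := Real.log (Real.log (Real.exp 1 - Real.log t))

/-- The reciprocal of the inner function `e − log t`. -/
noncomputable def invInner (t : ℝ) : ℝ := (Real.exp 1 - Real.log t)⁻¹

/-- The reciprocal of `log (e − log t)`. -/
noncomputable def invLogInner (t : ℝ) : ℝ := (Real.log (Real.exp 1 - Real.log t))⁻¹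

lemma one_lt_exp_one_sub_log {t : ℝ} (ht : t ∈ Set.Ioo (0 : ℝ) 1) :
    1 < Real.exp 1 - Real.log t := by
  have h₁ := Real.log_neg ht.1 ht.2
  have h₂ := Real.add_one_le_exp (1 : ℝ)
  linarith

lemma hasDerivAt_exp_one_sub_log {t : ℝ} (ht : t ≠ 0) :
    HasDerivAt (fun s => Real.exp 1 - Real.log s) (-t⁻¹) t := by
  simpa using (Real.hasDerivAt_log ht).const_sub (Real.exp 1)

lemma hasDerivAt_log_exp_one_sub_log {t : ℝ} (ht : t ∈ Set.Ioo (0 : ℝ) 1) :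
    HasDerivAt (fun s => Real.log (Real.exp 1 - Real.log s)) (-(invInner t / t)) t := by
  have hu := one_lt_exp_one_sub_log ht
  convert (hasDerivAt_exp_one_sub_log ht.1.ne').log (by linarith) using 1
  simp only [invInner]
  ring

lemma hasDerivAt_invInner {t : ℝ} (ht : t ∈ Set.Ioo (0 : ℝ) 1) :
    HasDerivAt invInner (invInner t ^ 2 / t) t := by
  have hu := one_lt_exp_one_sub_log ht
  refine HasDerivAt.congr_deriv ((hasDerivAt_exp_one_sub_log ht.1.ne').fun_inv (by linarith)) ?_
  simp only [invInner, neg_neg, inv_pow, div_eq_mul_inv]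
  exact mul_comm _ _

lemma hasDerivAt_invLogInner {t : ℝ} (ht : t ∈ Set.Ioo (0 : ℝ) 1) :
    HasDerivAt invLogInner (invInner t * invLogInner t ^ 2 / t) t := by
  have hL := Real.log_pos (one_lt_exp_one_sub_log ht)
  refine HasDerivAt.congr_deriv ((hasDerivAt_log_exp_one_sub_log ht).fun_inv hL.ne') ?_
  simp only [invLogInner]
  ring

lemma hasDerivAt_φ {t : ℝ} (ht : t ∈ Set.Ioo (0 : ℝ) 1) :
    HasDerivAt φ (-(invInner t * invLogInner t) / t) t := by
  have hL := Real.log_pos (one_lt_exp_one_sub_log ht)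
  refine HasDerivAt.congr_deriv ((hasDerivAt_log_exp_one_sub_log ht).log hL.ne') ?_
  simp only [invLogInner]
  ring

lemma deriv_deriv_φ {t : ℝ} (ht : t ∈ Set.Ioo (0 : ℝ) 1) :
    deriv (deriv φ) t =
      (invInner t * invLogInner t - invInner t ^ 2 * invLogInner t
        - invInner t ^ 2 * invLogInner t ^ 2) / t ^ 2 := by
  have heq : deriv φ =ᶠ[𝓝 t] fun s => -(invInner s * invLogInner s) / s := by
    filter_upwards [isOpen_Ioo.mem_nhds ht] with s hs using (hasDerivAt_φ hs).deriv
  have ht0 := ht.1.ne'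
  rw [heq.deriv_eq,
    (((hasDerivAt_invInner ht).fun_mul (hasDerivAt_invLogInner ht)).fun_neg.fun_div
      (hasDerivAt_id' t) ht0).deriv]
  field_simp
  ring

lemma deriv_deriv_deriv_φ {t : ℝ} (ht : t ∈ Set.Ioo (0 : ℝ) 1) :
    deriv (deriv (deriv φ)) t =
      (-2 * (invInner t * invLogInner t) + 3 * (invInner t ^ 2 * invLogInner t)
        + 3 * (invInner t ^ 2 * invLogInner t ^ 2) - 2 * (invInner t ^ 3 * invLogInner t)
        - 3 * (invInner t ^ 3 * invLogInner t ^ 2)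
        - 2 * (invInner t ^ 3 * invLogInner t ^ 3)) / t ^ 3 := by
  have heq : deriv (deriv φ) =ᶠ[𝓝 t] fun s =>
      (invInner s * invLogInner s - invInner s ^ 2 * invLogInner s
        - invInner s ^ 2 * invLogInner s ^ 2) / s ^ 2 := by
    filter_upwards [isOpen_Ioo.mem_nhds ht] with s hs using deriv_deriv_φ hs
  have ht0 := ht.1.ne'
  have ha := hasDerivAt_invInner ht
  have hb := hasDerivAt_invLogInner ht
  rw [heq.deriv_eq,
    ((((ha.fun_mul hb).fun_sub ((ha.fun_pow 2).fun_mul hb)).fun_sub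
      ((ha.fun_pow 2).fun_mul (hb.fun_pow 2))).fun_div
        ((hasDerivAt_id' t).fun_pow 2) (pow_ne_zero 2 ht0)).deriv]
  field_simp
  ring

lemma tendsto_exp_one_sub_log :
    Tendsto (fun t => Real.exp 1 - Real.log t) (𝓝[>] (0 : ℝ)) atTop := by
  simpa only [sub_eq_add_neg, Function.comp_apply] using
    tendsto_atTop_add_const_left _ _ (tendsto_neg_atBot_atTop.comp Real.tendsto_log_nhdsGT_zero)

lemma tendsto_invInner : Tendsto invInner (𝓝[>] (0 : ℝ)) (𝓝 0) :=
  tendsto_inv_atTop_zero.comp tendsto_exp_one_sub_log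

lemma tendsto_invLogInner : Tendsto invLogInner (𝓝[>] (0 : ℝ)) (𝓝 0) :=
  tendsto_inv_atTop_zero.comp (Real.tendsto_log_atTop.comp tendsto_exp_one_sub_log)

lemma tendsto_of_eq_invInner_invLogInner {f : ℝ → ℝ} {p : ℝ × ℝ → ℝ}
    (hp : Continuous p) (hp0 : p (0, 0) = 0)
    (hf : ∀ t ∈ Set.Ioo (0 : ℝ) 1, f t = p (invInner t, invLogInner t)) :
    Tendsto f (𝓝[>] (0 : ℝ)) (𝓝 0) := by
  have h := (hp.tendsto (0, 0)).comp (tendsto_invInner.prodMk_nhds tendsto_invLogInner)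
  rw [hp0] at h
  refine h.congr' ?_
  filter_upwards [Ioo_mem_nhdsGT (zero_lt_one' ℝ)] with t ht using (hf t ht).symm

/-- The functions `t φ'(t)`, `t² φ''(t)` and `t³ φ'''(t)` all tend to `0` as `t → 0⁺`. -/
theorem stmt_4 :
    Tendsto (fun t : ℝ => t * deriv φ t) (𝓝[>] (0 : ℝ)) (𝓝 0) ∧
    Tendsto (fun t : ℝ => t ^ 2 * deriv^[2] φ t) (𝓝[>] (0 : ℝ)) (𝓝 0) ∧
    Tendsto (fun t : ℝ => t ^ 3 * deriv^[3] φ t) (𝓝[>] (0 : ℝ)) (𝓝 0) := by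
  refine ⟨?_, ?_, ?_⟩
  · refine tendsto_of_eq_invInner_invLogInner (p := fun x => -(x.1 * x.2))
      (by fun_prop) (by simp) fun t ht => ?_
    rw [(hasDerivAt_φ ht).deriv, mul_div_cancel₀ _ ht.1.ne']
  · refine tendsto_of_eq_invInner_invLogInner
      (p := fun x => x.1 * x.2 - x.1 ^ 2 * x.2 - x.1 ^ 2 * x.2 ^ 2)
      (by fun_prop) (by simp) fun t ht => ?_
    change t ^ 2 * deriv (deriv φ) t = _
    rw [deriv_deriv_φ ht, mul_div_cancel₀ _ (pow_ne_zero 2 ht.1.ne')]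
  · refine tendsto_of_eq_invInner_invLogInner
      (p := fun x => -2 * (x.1 * x.2) + 3 * (x.1 ^ 2 * x.2) + 3 * (x.1 ^ 2 * x.2 ^ 2)
        - 2 * (x.1 ^ 3 * x.2) - 3 * (x.1 ^ 3 * x.2 ^ 2) - 2 * (x.1 ^ 3 * x.2 ^ 3))
      (by fun_prop) (by simp) fun t ht => ?_
    change t ^ 3 * deriv (deriv (deriv φ)) t = _
    rw [deriv_deriv_deriv_φ ht, mul_div_cancel₀ _ (pow_ne_zero 3 ht.1.ne')]
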